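/- arXiv:2210.12577 — 2 statements merged into one kernel-verified Lean document; each statement's English description precedes it below -/
import Mathlib

section
/- For every real number α with 0 < α < 1, there are infinitely many trees X with maximum degree 3 such that for every tree T with maximum degree at most 2, every T-partition of X has width at least |V(X)|^α. -/
open SimpleGraph

/-- The maximum degree of a finite simple graph `G`:
the supremum of the numbers of neighbours of its vertices. -/
noncomputable def maxDeg {V : Type*} [Fintype V] (G : SimpleGraph V) : ℕ :=
  sSup (Set.range fun v => (G.neighborSet v).ncard)

/-- `B` is a `T`-partition of the graph `G`: the tree `T` indexes a partition
`(B x : x ∈ V(T))` of `V(G)` such that for every edge `vw` of `G`, if `v ∈ B x` and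
`w ∈ B y` then `x = y` or `xy ∈ E(T)`. -/
structure IsTreePartition {V ι : Type*} (G : SimpleGraph V) (T : SimpleGraph ι)
    (B : ι → Set V) : Prop where
  /-- `T` is a tree. -/
  isTree : T.IsTree
  /-- the parts are nonempty -/
  part_nonempty : ∀ x, (B x).Nonempty
  /-- every vertex of `G` lies in exactly one part -/
  part_existsUnique : ∀ v, ∃! x, v ∈ B x
  /-- parts containing adjacent vertices are equal or adjacent in `T` -/
  part_adj : ∀ ⦃v w x y⦄, G.Adj v w → v ∈ B x → w ∈ B y → x = y ∨ T.Adj x y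

/-- `B` is a tree-decomposition of the graph `G` over the tree `T`:
every edge of `G` has both ends in a common bag, and for each vertex `v` of `G`
the set of nodes whose bag contains `v` induces a non-empty subtree of `T`. -/
structure IsTreeDecomp {V ι : Type*} (G : SimpleGraph V) (T : SimpleGraph ι)
    (B : ι → Set V) : Prop where
  /-- `T` is a tree. -/
  isTree : T.IsTree
  /-- every edge of `G` lies in some bag -/
  edge_mem : ∀ ⦃u v⦄, G.Adj u v → ∃ x, u ∈ B x ∧ v ∈ B x
  /-- the bags containing a given vertex induce a non-empty subtree -/
  subtree : ∀ v, (T.induce {x | v ∈ B x}).Connected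

/-- The treewidth of a finite graph: the minimum, over tree-decompositions,
of the maximum bag size minus one. -/
noncomputable def treewidth {V : Type} [Fintype V] (G : SimpleGraph V) : ℕ :=
  sInf {k | ∃ (ι : Type) (_ : Fintype ι) (T : SimpleGraph ι) (B : ι → Set V),
    IsTreeDecomp G T B ∧ ∀ x, (B x).ncard ≤ k + 1}

/-- The tree-partition-width of a finite graph: the minimum width of a tree-partition. -/
noncomputable def tpw {V : Type} [Fintype V] (G : SimpleGraph V) : ℕ :=
  sInf {k | ∃ (ι : Type) (_ : Fintype ι) (T : SimpleGraph ι) (B : ι → Set V),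
    IsTreePartition G T B ∧ ∀ x, (B x).ncard ≤ k}

/-- In a connected graph, a vertex other than `x` has a neighbour one step closer to `x`. -/
lemma SimpleGraph.Connected.exists_adj_dist_eq {V : Type*} {G : SimpleGraph V}
    (hG : G.Connected) {x y : V} {k : ℕ} (h : G.dist x y = k + 1) :
    ∃ z, G.Adj y z ∧ G.dist x z = k := by
  obtain ⟨p, hp⟩ := hG.exists_walk_length_eq_dist y x
  rw [SimpleGraph.dist_comm, h] at hp
  cases p with
  | nil => simp at hp
  | @cons _ z _ hadj q =>
    have hq : q.length = k := by simpa using hp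
    have hle : G.dist x z ≤ k := by
      rw [SimpleGraph.dist_comm, ← hq]
      exact SimpleGraph.dist_le q
    have htri : G.dist x y ≤ G.dist x z + G.dist z y := hG.dist_triangle
    rw [SimpleGraph.dist_eq_one_iff_adj.2 hadj.symm] at htri
    exact ⟨z, hadj, by omega⟩

lemma ncard_sphere_le_two {V : Type*} [Finite V] {G : SimpleGraph V} (hG : G.Connected)
    (hdeg : ∀ x, (G.neighborSet x).ncard ≤ 2) (x : V) (k : ℕ) :
    {y | G.dist x y = k + 1}.ncard ≤ 2 := by
  induction k with
  | zero =>
    convert hdeg x using 2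
    ext y
    simp
  | succ k ih =>
    refine le_trans ?_ ih
    have hpred : ∀ y, ∃ z, G.dist x y = k + 1 + 1 → G.Adj y z ∧ G.dist x z = k + 1 := by
      intro y
      by_cases h : G.dist x y = k + 1 + 1
      · obtain ⟨z, hz⟩ := hG.exists_adj_dist_eq h
        exact ⟨z, fun _ => hz⟩
      · exact ⟨x, fun h' => absurd h' h⟩
    choose f hf using hpred
    refine Set.ncard_le_ncard_of_injOn f (fun y hy => (hf y hy).2) ?_
    intro a ha b hb hab
    by_contra hne
    obtain ⟨haz, hz⟩ := hf a ha
    obtain ⟨hbz, -⟩ := hf b hb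
    rw [← hab] at hbz
    obtain ⟨c, hc, hcd⟩ := hG.exists_adj_dist_eq hz
    simp only [Set.mem_ofPred_eq] at ha hb
    have hac : a ≠ c := by rintro rfl; omega
    have hbc : b ≠ c := by rintro rfl; omega
    have hsub : ({a, b, c} : Set V) ⊆ G.neighborSet (f a) := by
      rintro v (rfl | rfl | rfl)
      exacts [haz.symm, hbz.symm, hc]
    have h3 := Set.ncard_le_ncard hsub
    rw [Set.ncard_eq_three.2 ⟨a, b, c, hne, hac, hbc, rfl⟩] at h3
    have := hdeg (f a)
    omega

lemma ncard_dist_le_le {V : Type*} [Finite V] {G : SimpleGraph V} (hG : G.Connected)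
    (hdeg : ∀ x, (G.neighborSet x).ncard ≤ 2) (x : V) (k : ℕ) :
    {y | G.dist x y ≤ k}.ncard ≤ 2 * k + 1 := by
  induction k with
  | zero =>
    have : {y | G.dist x y ≤ 0} = {x} := by
      ext y
      rw [Set.mem_ofPred_eq, Nat.le_zero, hG.dist_eq_zero_iff, Set.mem_singleton_iff, eq_comm]
    rw [this, Set.ncard_singleton]
  | succ k ih =>
    have : {y | G.dist x y ≤ k + 1} = {y | G.dist x y ≤ k} ∪ {y | G.dist x y = k + 1} := by
      ext y
      simp only [Set.mem_ofPred_eq, Set.mem_union]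
      omega
    rw [this]
    have h1 := Set.ncard_union_le {y | G.dist x y ≤ k} {y | G.dist x y = k + 1}
    have h2 := ncard_sphere_le_two hG hdeg x k
    omega

/-- The binary heap on `N` vertices: the children of `i` are `2 * i + 1` and `2 * i + 2`. -/
def binaryHeap (N : ℕ) : SimpleGraph (Fin N) where
  Adj i j := (0 < j.val ∧ i.val = (j.val - 1) / 2) ∨ (0 < i.val ∧ j.val = (i.val - 1) / 2)
  symm := ⟨fun _ _ h => h.symm⟩
  loopless := ⟨fun i h => by omega⟩

lemma binaryHeap_adj {N : ℕ} {i j : Fin N} : (binaryHeap N).Adj i j ↔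
    (0 < j.val ∧ i.val = (j.val - 1) / 2) ∨ (0 < i.val ∧ j.val = (i.val - 1) / 2) :=
  Iff.rfl

/-- The parent of a vertex of the binary heap; the root is its own parent. -/
def heapParent {N : ℕ} (i : Fin N) : Fin N := ⟨(i.val - 1) / 2, by omega⟩

lemma binaryHeap_adj_heapParent {N : ℕ} {i : Fin N} (hi : 0 < i.val) :
    (binaryHeap N).Adj i (heapParent i) :=
  Or.inr ⟨hi, rfl⟩

lemma binaryHeap_connected {N : ℕ} (hN : 0 < N) : (binaryHeap N).Connected := by
  have hroot : ∀ n (h : n < N), (binaryHeap N).Reachable ⟨n, h⟩ ⟨0, hN⟩ := by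
    intro n
    induction n using Nat.strong_induction_on with
    | _ n ih =>
      intro h
      rcases Nat.eq_zero_or_pos n with rfl | hn
      · rfl
      · exact (binaryHeap_adj_heapParent (i := ⟨n, h⟩) hn).reachable.trans
          (ih ((n - 1) / 2) (by omega) (by omega))
  have : Nonempty (Fin N) := ⟨⟨0, hN⟩⟩
  exact ⟨fun u v => (hroot u u.2).trans (hroot v v.2).symm⟩

lemma binaryHeap_edgeSet {N : ℕ} : (binaryHeap N).edgeSet =
    (fun i : Fin N => s(i, heapParent i)) '' {i | 0 < i.val} := by
  ext e
  induction e with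
  | _ a b =>
    simp only [SimpleGraph.mem_edgeSet, Set.mem_image, Set.mem_ofPred_eq]
    constructor
    · rintro (⟨hb, h⟩ | ⟨ha, h⟩)
      · exact ⟨b, hb, by rw [Sym2.eq_swap, show heapParent b = a from Fin.ext h.symm]⟩
      · exact ⟨a, ha, by rw [show heapParent a = b from Fin.ext h.symm]⟩
    · rintro ⟨i, hi, h⟩
      rw [← SimpleGraph.mem_edgeSet, ← h]
      exact binaryHeap_adj_heapParent hi

lemma binaryHeap_isTree {N : ℕ} (hN : 0 < N) : (binaryHeap N).IsTree := by
  refine SimpleGraph.isTree_iff_connected_and_card.2 ⟨binaryHeap_connected hN, ?_⟩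
  rw [Nat.card_coe_set_eq, binaryHeap_edgeSet, Set.InjOn.ncard_image]
  · have : {i : Fin N | 0 < i.val} = {⟨0, hN⟩}ᶜ := by
      ext i
      simp [Fin.ext_iff, Nat.pos_iff_ne_zero]
    rw [this, Set.ncard_compl, Set.ncard_singleton, Nat.card_fin]
    omega
  · intro a ha b hb h
    simp only [Set.mem_ofPred_eq] at ha hb
    simp only [Sym2.eq_iff, Fin.ext_iff, heapParent] at h
    exact Fin.ext (by omega)

lemma maxDeg_binaryHeap {N : ℕ} (hN : 5 ≤ N) : maxDeg (binaryHeap N) = 3 := by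
  have hle : ∀ i, ((binaryHeap N).neighborSet i).ncard ≤ 3 := by
    intro i
    calc ((binaryHeap N).neighborSet i).ncard
        ≤ ({(i.val - 1) / 2, 2 * i.val + 1, 2 * i.val + 2} : Set ℕ).ncard := by
          refine Set.ncard_le_ncard_of_injOn Fin.val ?_ Fin.val_injective.injOn
          intro j hj
          simp only [SimpleGraph.mem_neighborSet, binaryHeap_adj] at hj
          simp only [Set.mem_insert_iff, Set.mem_singleton_iff]
          omega
      _ ≤ 3 := by
          refine (Set.ncard_insert_le _ _).trans (Nat.succ_le_succ ?_)
          exact (Set.ncard_insert_le _ _).trans (by rw [Set.ncard_singleton])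
  have hbdd : BddAbove (Set.range fun i => ((binaryHeap N).neighborSet i).ncard) :=
    ⟨3, by rintro _ ⟨i, rfl⟩; exact hle i⟩
  have : Nonempty (Fin N) := ⟨⟨0, by omega⟩⟩
  refine le_antisymm (csSup_le (Set.range_nonempty _) ?_) ?_
  · rintro _ ⟨i, rfl⟩
    exact hle i
  · refine le_trans ?_ (le_csSup hbdd ⟨⟨1, by omega⟩, rfl⟩)
    have hsub : ({⟨0, by omega⟩, ⟨3, by omega⟩, ⟨4, by omega⟩} : Set (Fin N)) ⊆
        (binaryHeap N).neighborSet ⟨1, by omega⟩ := by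
      rintro v (rfl | rfl | rfl) <;> simp [binaryHeap_adj]
    refine le_trans (le_of_eq ?_) (Set.ncard_le_ncard hsub)
    exact (Set.ncard_eq_three.2 ⟨_, _, _, by simp, by simp, by simp, rfl⟩).symm

lemma dist_binaryHeap_map_le {N : ℕ} (hN : 0 < N) {ι : Type*} {T : SimpleGraph ι}
    (hT : T.Connected) (f : Fin N → ι)
    (hf : ∀ i j, (binaryHeap N).Adj i j → f i = f j ∨ T.Adj (f i) (f j))
    (n : ℕ) (h : n < N) : T.dist (f ⟨0, hN⟩) (f ⟨n, h⟩) ≤ Nat.log 2 (n + 1) := by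
  induction n using Nat.strong_induction_on with
  | _ n ih =>
    rcases Nat.eq_zero_or_pos n with rfl | hn
    · simp
    have hp : (n - 1) / 2 < N := by omega
    have hrec := ih ((n - 1) / 2) (by omega) hp
    have hlog : Nat.log 2 (n + 1) = Nat.log 2 ((n - 1) / 2 + 1) + 1 := by
      rw [Nat.log_of_one_lt_of_le one_lt_two (by omega : 2 ≤ n + 1)]
      congr 2
      omega
    have hstep : T.dist (f ⟨(n - 1) / 2, hp⟩) (f ⟨n, h⟩) ≤ 1 := by
      rcases hf _ _ (binaryHeap_adj_heapParent (i := ⟨n, h⟩) hn).symm with he | he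
      · exact (congrArg (T.dist · (f ⟨n, h⟩)) he).trans_le (by simp)
      · exact (SimpleGraph.dist_eq_one_iff_adj.2 he).le
    have htri := hT.dist_triangle (u := f ⟨0, hN⟩) (v := f ⟨(n - 1) / 2, hp⟩) (w := f ⟨n, h⟩)
    omega

lemma card_le_of_isTreePartition_binaryHeap {N : ℕ} (hN : 0 < N) {ι : Type*} [Fintype ι]
    {T : SimpleGraph ι} {B : ι → Set (Fin N)} (hdeg : ∀ x, (T.neighborSet x).ncard ≤ 2)
    (hB : IsTreePartition (binaryHeap N) T B) : Fintype.card ι ≤ 2 * Nat.log 2 N + 1 := by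
  choose f hf using fun v => (hB.part_existsUnique v).exists
  have huniv : (Set.univ : Set ι) ⊆ {y | T.dist (f ⟨0, hN⟩) y ≤ Nat.log 2 N} := by
    intro y _
    obtain ⟨v, hv⟩ := hB.part_nonempty y
    rw [(hB.part_existsUnique v).unique hv (hf v)]
    exact (dist_binaryHeap_map_le hN hB.isTree.connected f
      (fun i j hij => hB.part_adj hij (hf i) (hf j)) v v.2).trans (Nat.log_mono_right v.2)
  calc Fintype.card ι = (Set.univ : Set ι).ncard := by
        rw [Set.ncard_univ, Nat.card_eq_fintype_card]
    _ ≤ _ := Set.ncard_le_ncard huniv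
    _ ≤ _ := ncard_dist_le_le hB.isTree.connected hdeg _ _

lemma eventually_two_mul_log_add_one_le_rpow {β : ℝ} (hβ : 0 < β) :
    ∀ᶠ N : ℕ in Filter.atTop, ((2 * Nat.log 2 N + 1 : ℕ) : ℝ) ≤ (N : ℝ) ^ β := by
  have hlog2 : 0 < Real.log 2 := Real.log_pos one_lt_two
  have ho := ((isLittleO_log_rpow_atTop hβ).def
    (by positivity : 0 < Real.log 2 / 3)).natCast_atTop
  filter_upwards [ho, Filter.eventually_ge_atTop 2] with N hN h2
  have h2' : (2 : ℝ) ≤ N := by exact_mod_cast h2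
  have hmono : Real.log 2 ≤ Real.log N := Real.log_le_log (by norm_num) h2'
  rw [Real.norm_of_nonneg (by linarith), Real.norm_of_nonneg (by positivity)] at hN
  have hnat : (Nat.log 2 N : ℝ) * Real.log 2 ≤ Real.log N := by
    have := Real.natLog_le_logb N 2
    rwa [Real.logb, Nat.cast_ofNat, le_div_iff₀ hlog2] at this
  push_cast
  refine le_of_mul_le_mul_right ?_ hlog2
  linarith

lemma IsTreePartition.card_le_sum_ncard {V ι : Type*} [Fintype V] [Fintype ι] {G : SimpleGraph V}
    {T : SimpleGraph ι} {B : ι → Set V} (hB : IsTreePartition G T B) :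
    Fintype.card V ≤ ∑ x, (B x).ncard := by
  have huniv : (⋃ x, B x) = Set.univ :=
    Set.eq_univ_of_forall fun v => Set.mem_iUnion.2 (hB.part_existsUnique v).exists
  rw [← Nat.card_eq_fintype_card, ← Set.ncard_univ, ← huniv]
  simpa using Finset.univ.set_ncard_biUnion_le B

/-- For every real `α` with `0 < α < 1`, there are infinitely many trees
`X` with maximum degree `3` such that for every tree `T` with maximum degree at most `2`,
every `T`-partition of `X` has width at least `|V(X)|^α`. -/
theorem exists_cubic_trees_forcing_large_width (α : ℝ) (hα₀ : 0 < α) (hα₁ : α < 1) :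
    ∀ n : ℕ, ∃ (κ : Type) (_ : Fintype κ) (X : SimpleGraph κ),
      X.IsTree ∧ maxDeg X = 3 ∧ n ≤ Fintype.card κ ∧
      ∀ (ι : Type) (_ : Fintype ι) (T : SimpleGraph ι) (B : ι → Set κ),
        (∀ x, (T.neighborSet x).ncard ≤ 2) → IsTreePartition X T B →
        ∃ x, ((Fintype.card κ : ℝ)) ^ α ≤ ((B x).ncard : ℝ) := by
  intro n
  obtain ⟨N, hlog, hN⟩ := ((eventually_two_mul_log_add_one_le_rpow (sub_pos.2 hα₁)).and
    (Filter.eventually_ge_atTop (max n 5))).exists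
  have hN5 : 5 ≤ N := (le_max_right _ _).trans hN
  have hpos : (0 : ℝ) < N := by exact_mod_cast (by omega : 0 < N)
  refine ⟨Fin N, inferInstance, binaryHeap N, binaryHeap_isTree (by omega),
    maxDeg_binaryHeap hN5, by simpa using (le_max_left _ _).trans hN, ?_⟩
  intro ι _ T B hdeg hB
  by_contra! hlt
  have := hB.isTree.connected.nonempty
  rw [Fintype.card_fin] at hlt
  have hsum : (N : ℝ) ≤ ∑ x, ((B x).ncard : ℝ) := by
    exact_mod_cast (Fintype.card_fin N).symm.trans_le hB.card_le_sum_ncard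
  have hcard : (Fintype.card ι : ℝ) ≤ (N : ℝ) ^ (1 - α) :=
    (Nat.cast_le.2 (card_le_of_isTreePartition_binaryHeap (by omega) hdeg hB)).trans hlog
  have : (N : ℝ) < N := calc
    (N : ℝ) ≤ ∑ x, ((B x).ncard : ℝ) := hsum
    _ < ∑ _x : ι, (N : ℝ) ^ α :=
      Finset.sum_lt_sum_of_nonempty Finset.univ_nonempty fun x _ => hlt x
    _ = Fintype.card ι * (N : ℝ) ^ α := by simp
    _ ≤ (N : ℝ) ^ (1 - α) * (N : ℝ) ^ α := by gcongr
    _ = N := by rw [← Real.rpow_add hpos, sub_add_cancel, Real.rpow_one]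
  exact lt_irrefl _ this
end

section
/- Fix positive integers k and d and a real number α > 2. Every graph G with tw(G) ≤ k − 1 and Δ(G) ≤ d has a tree-partition (B_x : x ∈ V(T)) of width at most (3α(α−1)/(α−2))·kd − (α/(α−2))·k over a tree T with Δ(T) ≤ (3α/(α−2))·d + (α−4)/(α−2). -/
open SimpleGraph

namespace SimpleGraph

section Branch

variable {ι : Type*} {T : SimpleGraph ι}

/-- The nodes that can be reached from `y` by a walk avoiding `x`. When `T` is a tree and `y` is
a neighbour of `x`, this is the component of `T - x` that contains `y`. -/
def branch (T : SimpleGraph ι) (x y : ι) : Set ι :=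
  {z | ∃ p : T.Walk y z, x ∉ p.support}

theorem mem_branch_self {x y : ι} (h : x ≠ y) : y ∈ T.branch x y :=
  ⟨.nil, by simpa using h⟩

theorem IsAcyclic.mem_edges_of_adj (hT : T.IsAcyclic) {x y : ι} (h : T.Adj x y)
    (p : T.Walk x y) : s(x, y) ∈ p.edges :=
  isBridge_iff_forall_walk_mem_edges.1 (isAcyclic_iff_forall_adj_isBridge.1 hT h) p

theorem IsAcyclic.disjoint_branch (hT : T.IsAcyclic) {x y : ι} (h : T.Adj x y) :
    Disjoint (T.branch x y) (T.branch y x) := by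
  rw [Set.disjoint_left]
  rintro z ⟨p, hp⟩ ⟨q, hq⟩
  have := hT.mem_edges_of_adj h (q.append p.reverse)
  rw [Walk.edges_append, List.mem_append] at this
  rcases this with h' | h'
  · exact hq (q.snd_mem_support_of_mem_edges h')
  · rw [Walk.edges_reverse, List.mem_reverse] at h'
    exact hp (p.fst_mem_support_of_mem_edges h')

theorem IsAcyclic.eq_of_mem_branch (hT : T.IsAcyclic) {x y z : ι} (hy : T.Adj x y)
    (hz : T.Adj x z) (h : z ∈ T.branch x y) : y = z := by
  obtain ⟨p, hp⟩ := h
  have := hT.mem_edges_of_adj hy (Walk.cons hz p.reverse)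
  rw [Walk.edges_cons, List.mem_cons, Walk.edges_reverse, List.mem_reverse] at this
  rcases this with h' | h'
  · rcases Sym2.eq_iff.1 h' with h' | h'
    · exact h'.2
    · exact absurd h'.1 hz.ne
  · exact absurd (p.fst_mem_support_of_mem_edges h') hp

theorem IsAcyclic.eq_of_mem_branch_of_mem_branch (hT : T.IsAcyclic) {x y z a : ι}
    (hy : T.Adj x y) (hz : T.Adj x z) (h : a ∈ T.branch x y) (h' : a ∈ T.branch x z) :
    y = z := by
  obtain ⟨p, hp⟩ := h
  obtain ⟨q, hq⟩ := h'
  refine hT.eq_of_mem_branch hy hz ⟨p.append q.reverse, ?_⟩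
  simp [Walk.mem_support_append_iff, hp, hq]

theorem IsAcyclic.branch_ssubset (hT : T.IsAcyclic) {x y z : ι} (hy : T.Adj x y)
    (hz : T.Adj y z) (hne : z ≠ x) : T.branch y z ⊂ T.branch x y := by
  classical
  refine Set.ssubset_iff_of_subset ?_ |>.2 ⟨y, mem_branch_self hy.ne, fun ⟨p, hp⟩ => ?_⟩
  · rintro a ⟨p, hp⟩
    refine ⟨Walk.cons hz p, ?_⟩
    rw [Walk.support_cons, List.mem_cons, not_or]
    refine ⟨hy.ne, fun hx => hne (hT.eq_of_mem_branch hz hy.symm ⟨p.takeUntil x hx, ?_⟩)⟩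
    exact fun h => hp (p.support_takeUntil_subset_support hx h)
  · exact hp p.end_mem_support

theorem Connected.exists_mem_branch (hT : T.Connected) {x a : ι} (h : a ≠ x) :
    ∃ y, T.Adj x y ∧ a ∈ T.branch x y := by
  obtain ⟨p, hp⟩ := hT.exists_isPath x a
  cases p with
  | nil => exact absurd rfl h
  | cons hy q => exact ⟨_, hy, q, ((Walk.cons_isPath_iff _ _).1 hp).2⟩

theorem subset_branch {s : Set ι} (hs : (T.induce s).Connected) {x y a : ι} (hx : x ∉ s)
    (ha : a ∈ s) (hay : a ∈ T.branch x y) : s ⊆ T.branch x y := by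
  intro b hb
  obtain ⟨p, hp⟩ := hay
  obtain ⟨q⟩ := hs.preconnected ⟨a, ha⟩ ⟨b, hb⟩
  let r : T.Walk a b := q.map (Embedding.induce s).toHom
  have hr : x ∉ r.support := fun h => by
    obtain ⟨c, -, rfl⟩ := List.mem_map.1 (Walk.support_map (Embedding.induce s).toHom q ▸ h)
    exact hx c.2
  refine ⟨p.append r, fun h => ?_⟩
  rcases (Walk.mem_support_append_iff _ _).1 h with h | h
  · exact hp h
  · exact hr h

end Branch

theorem IsTree.sum_sup_edge {ι κ : Type*} [Finite ι] [Finite κ] {T : SimpleGraph ι}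
    {T' : SimpleGraph κ} (hT : T.IsTree) (hT' : T'.IsTree) (x : ι) (y : κ) :
    (T.sum T' ⊔ edge (.inl x) (.inr y)).IsTree := by
  have hc := hT.connected.sum_sup_edge (v := x) (w := y) hT'.connected
  refine isTree_iff_connected_and_card.2 ⟨hc, le_antisymm ?_ ?_⟩
  · have h1 := (isTree_iff_connected_and_card.1 hT).2
    have h2 := (isTree_iff_connected_and_card.1 hT').2
    have h3 : Nat.card (T.sum T').edgeSet = Nat.card T.edgeSet + Nat.card T'.edgeSet := by
      rw [Nat.card_congr edgeSetSumEquiv, Nat.card_sum]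
    have h4 : Nat.card (T.sum T' ⊔ edge (Sum.inl x) (Sum.inr y)).edgeSet ≤
        Nat.card (T.sum T').edgeSet + 1 := by
      rw [edgeSet_sup]
      refine (Set.ncard_union_le _ _).trans (Nat.add_le_add_left ?_ _)
      rw [edgeSet_edge]
      exact (Set.ncard_le_ncard Set.sdiff_subset).trans (Set.ncard_singleton _).le
    rw [Nat.card_sum]
    omega
  · exact hc.card_vert_le_card_edgeSet_add_one

end SimpleGraph

section Separator

variable {V ι : Type*} [Fintype ι] {G : SimpleGraph V} {T : SimpleGraph ι} {B : ι → Set V}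

open Classical in
/-- The vertices of `S` all of whose bags lie in the branch of `T` at `x` towards `y`. -/
noncomputable def branchPart (T : SimpleGraph ι) (B : ι → Set V) (S : Finset V) (x y : ι) :
    Finset V :=
  {v ∈ S | {a | v ∈ B a} ⊆ T.branch x y}

theorem IsTreeDecomp.exists_node_balanced (h : IsTreeDecomp G T B) (S : Finset V) :
    ∃ x, ∀ y, T.Adj x y → 2 * (branchPart T B S x y).card ≤ S.card := by
  classical
  by_contra! hcon
  have key : ∀ n x y, (T.branch x y).ncard = n → T.Adj x y →
      ¬ S.card < 2 * (branchPart T B S x y).card := by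
    intro n
    induction n using Nat.strong_induction_on with
    | _ n ih =>
      intro x y hn hxy hlt
      obtain ⟨z, hyz, hz⟩ := hcon y
      by_cases hne : z = x
      · subst hne
        have hd : Disjoint (branchPart T B S z y) (branchPart T B S y z) := by
          rw [Finset.disjoint_left]
          intro v hv hv'
          obtain ⟨⟨a, ha⟩⟩ := (h.subtree v).nonempty
          exact Set.disjoint_left.1 (h.isTree.isAcyclic.disjoint_branch hxy)
            ((Finset.mem_filter.1 hv).2 ha) ((Finset.mem_filter.1 hv').2 ha)
        have hle := Finset.card_le_card (Finset.union_subset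
          (show branchPart T B S z y ⊆ S from Finset.filter_subset _ _)
          (show branchPart T B S y z ⊆ S from Finset.filter_subset _ _))
        rw [Finset.card_union_of_disjoint hd] at hle
        omega
      · exact ih _ (hn ▸ Set.ncard_lt_ncard (h.isTree.isAcyclic.branch_ssubset hxy hyz hne))
          y z rfl hyz hz
  obtain ⟨x⟩ := h.isTree.connected.nonempty
  obtain ⟨y, hxy, hy⟩ := hcon x
  exact key _ x y rfl hxy hy

/-- A family of weights none of which exceeds half of the total can be split into two parts of at
most two thirds of the total each. -/
theorem Finset.exists_balanced_coloring [DecidableEq ι] (M : Finset V) (c : V → ι) (s : ℕ)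
    (hM : M.card ≤ s) (hc : ∀ i, 2 * {v ∈ M | c v = i}.card ≤ s) :
    ∃ J : Finset ι, 3 * {v ∈ M | c v ∈ J}.card ≤ 2 * s ∧ 3 * {v ∈ M | c v ∉ J}.card ≤ 2 * s := by
  classical
  obtain ⟨J, hJ, hmax⟩ := Finset.exists_max_image
    (Finset.univ.filter fun J : Finset ι => 3 * {v ∈ M | c v ∈ J}.card ≤ 2 * s) Finset.card
    ⟨∅, by simp⟩
  replace hJ := (Finset.mem_filter.1 hJ).2
  have hsplit : ∀ J : Finset ι, {v ∈ M | c v ∈ J}.card + {v ∈ M | c v ∉ J}.card = M.card :=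
    fun J => Finset.card_filter_add_card_filter_not _
  by_cases hJ' : 3 * {v ∈ M | c v ∉ J}.card ≤ 2 * s
  · exact ⟨J, hJ, hJ'⟩
  obtain ⟨v, hv⟩ : {v ∈ M | c v ∉ J}.Nonempty := by
    rw [← Finset.card_pos]; omega
  have hvJ := (Finset.mem_filter.1 hv).2
  have hbig : ¬ 3 * {u ∈ M | c u ∈ insert (c v) J}.card ≤ 2 * s := fun hle => by
    have := hmax (insert (c v) J) (by simpa using hle)
    rw [Finset.card_insert_of_notMem hvJ] at this
    omega
  have hins : {u ∈ M | c u ∈ insert (c v) J}.card ≤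
      {u ∈ M | c u = c v}.card + {u ∈ M | c u ∈ J}.card := by
    refine (Finset.card_le_card fun u => ?_).trans (Finset.card_union_le _ _)
    simp only [Finset.mem_filter, Finset.mem_insert, Finset.mem_union]
    tauto
  have h1 := hsplit J
  have h2 := hsplit {c v}
  have h3 := hc (c v)
  simp only [Finset.mem_singleton] at h2
  refine ⟨{c v}, ?_, ?_⟩ <;> simp only [Finset.mem_singleton] <;> omega

/-- Balanced separations from a tree-decomposition: some bag `X` together with a set `P` of
vertices such that no edge leaves `P` except into `X`, both sides being balanced with respect
to `S`. -/
theorem IsTreeDecomp.exists_balanced_separation (h : IsTreeDecomp G T B)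
    (S : Finset V) :
    ∃ x, ∃ P : Set V, (∀ ⦃u v⦄, G.Adj u v → u ∉ B x → v ∉ B x → (u ∈ P ↔ v ∈ P)) ∧
      (∀ S' ⊆ S, (∀ v ∈ S', v ∉ B x ∧ v ∈ P) → 3 * S'.card ≤ 2 * S.card) ∧
      (∀ S' ⊆ S, (∀ v ∈ S', v ∉ B x ∧ v ∉ P) → 3 * S'.card ≤ 2 * S.card) := by
  classical
  obtain ⟨x, hx⟩ := h.exists_node_balanced S
  have hex : ∀ v, ∃ y, v ∉ B x → T.Adj x y ∧ {a | v ∈ B a} ⊆ T.branch x y := by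
    intro v
    by_cases hv : v ∈ B x
    · exact ⟨x, fun h' => absurd hv h'⟩
    obtain ⟨⟨a, ha⟩⟩ := (h.subtree v).nonempty
    obtain ⟨y, hxy, hay⟩ := h.isTree.connected.exists_mem_branch (x := x) (a := a)
      (by rintro rfl; exact hv ha)
    exact ⟨y, fun _ => ⟨hxy, SimpleGraph.subset_branch (h.subtree v) hv ha hay⟩⟩
  choose c hc using hex
  obtain ⟨J, hJ, hJ'⟩ := Finset.exists_balanced_coloring {v ∈ S | v ∉ B x} c S.card
    (Finset.card_filter_le _ _) (fun i => by
      by_cases hi : T.Adj x i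
      · refine le_trans (Nat.mul_le_mul_left _ (Finset.card_le_card fun v hv => ?_)) (hx i hi)
        simp only [Finset.mem_filter] at hv
        exact Finset.mem_filter.2 ⟨hv.1.1, hv.2 ▸ (hc v hv.1.2).2⟩
      · rw [Finset.filter_false_of_mem]
        · simp
        · rintro v hv rfl
          exact hi (hc v (Finset.mem_filter.1 hv).2).1)
  refine ⟨x, {v | c v ∈ J}, ?_, ?_, ?_⟩
  · intro u v huv hu hv
    obtain ⟨a, hau, hav⟩ := h.edge_mem huv
    have : c u = c v := h.isTree.isAcyclic.eq_of_mem_branch_of_mem_branch (hc u hu).1 (hc v hv).1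
      ((hc u hu).2 hau) ((hc v hv).2 hav)
    simp [this]
  · refine fun S' hS' hP => (Nat.mul_le_mul_left _ (Finset.card_le_card fun v hv => ?_)).trans hJ
    exact Finset.mem_filter.2 ⟨Finset.mem_filter.2 ⟨hS' hv, (hP v hv).1⟩, (hP v hv).2⟩
  · refine fun S' hS' hP => (Nat.mul_le_mul_left _ (Finset.card_le_card fun v hv => ?_)).trans hJ'
    exact Finset.mem_filter.2 ⟨Finset.mem_filter.2 ⟨hS' hv, (hP v hv).1⟩, (hP v hv).2⟩

end Separator

theorem exists_isTreeDecomp_ncard_le {V : Type} [Fintype V] (G : SimpleGraph V) :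
    ∃ (ι : Type) (_ : Fintype ι) (T : SimpleGraph ι) (B : ι → Set V),
      IsTreeDecomp G T B ∧ ∀ x, (B x).ncard ≤ treewidth G + 1 := by
  refine Nat.sInf_mem (s := {k | ∃ (ι : Type) (_ : Fintype ι) (T : SimpleGraph ι) (B : ι → Set V),
    IsTreeDecomp G T B ∧ ∀ x, (B x).ncard ≤ k + 1}) ⟨Fintype.card V, Unit, inferInstance, ⊥,
      fun _ => Set.univ, ⟨.of_subsingleton, fun u v _ => ⟨(), trivial, trivial⟩, fun v => ?_⟩,
      fun _ => ?_⟩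
  · have : Nonempty {x : Unit | v ∈ (Set.univ : Set V)} := ⟨⟨(), trivial⟩⟩
    exact (SimpleGraph.IsTree.of_subsingleton (V := {x : Unit | v ∈ (Set.univ : Set V)})).connected
  · rw [Set.ncard_univ, Nat.card_eq_fintype_card]
    omega

theorem ncard_neighborSet_le_maxDeg {V : Type*} [Fintype V] (G : SimpleGraph V) (v : V) :
    (G.neighborSet v).ncard ≤ maxDeg G :=
  le_csSup (Set.finite_range _).bddAbove ⟨v, rfl⟩

section RootedTreePartition

variable {V : Type} [DecidableEq V] {G : SimpleGraph V} {W D : ℝ}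

/-- `HasRootedTreePartition G W D U R n`: the subgraph of `G` induced by `U` has a tree-partition
over a rooted tree whose root has part `R` and exactly `n` children, all other parts having size
at most `W` and all other nodes having degree at most `D`. -/
inductive HasRootedTreePartition (G : SimpleGraph V) (W D : ℝ) :
    Finset V → Finset V → ℕ → Prop
  | single (R : Finset V) (hR : R.Nonempty) : HasRootedTreePartition G W D R R 0
  | graft {U R U' R' : Finset V} {n m : ℕ} (h : HasRootedTreePartition G W D U R n)
      (h' : HasRootedTreePartition G W D U' R' m) (hd : Disjoint U U')
      (hadj : ∀ u ∈ U, ∀ v ∈ U', G.Adj u v → u ∈ R ∧ v ∈ R')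
      (hW : (R'.card : ℝ) ≤ W) (hD : (m : ℝ) + 1 ≤ D) :
      HasRootedTreePartition G W D (U ∪ U') R (n + 1)

namespace HasRootedTreePartition

theorem root_subset {U R : Finset V} {n : ℕ} (h : HasRootedTreePartition G W D U R n) :
    R ⊆ U := by
  induction h with
  | single => exact subset_rfl
  | graft _ _ _ _ _ _ ih _ => exact ih.trans Finset.subset_union_left

theorem union_root {U R : Finset V} {n : ℕ} (h : HasRootedTreePartition G W D U R n)
    (A : Finset V) (hA : Disjoint U A) (hadj : ∀ u ∈ U, ∀ v ∈ A, G.Adj u v → u ∈ R) :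
    HasRootedTreePartition G W D (U ∪ A) (R ∪ A) n := by
  induction h with
  | single R hR => exact .single _ (hR.mono Finset.subset_union_left)
  | @graft U R U' R' n m h h' hd hadj' hW hD ih _ =>
    rw [Finset.disjoint_union_left] at hA
    have hR := h.root_subset
    rw [Finset.union_right_comm]
    refine (ih hA.1 fun u hu => hadj u (Finset.mem_union_left _ hu)).graft h'
      (Finset.disjoint_union_left.2 ⟨hd, hA.2.symm⟩) (fun u hu v hv huv => ?_) hW hD
    rcases Finset.mem_union.1 hu with hu | hu
    · exact (hadj' u hu v hv huv).imp_left (Finset.mem_union_left _)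
    · exact absurd (hR (hadj v (Finset.mem_union_right _ hv) u hu huv.symm))
        (Finset.disjoint_right.1 hd hv)

theorem merge_of_root_eq {U U' R : Finset V} {n m : ℕ}
    (h : HasRootedTreePartition G W D U R n) (h' : HasRootedTreePartition G W D U' R m)
    (hd : U ∩ U' ⊆ R) (hadj : ∀ u ∈ U, ∀ v ∈ U', G.Adj u v → u ∈ R ∨ v ∈ R) :
    HasRootedTreePartition G W D (U ∪ U') R (n + m) := by
  induction h' with
  | single R hR => rwa [Finset.union_eq_left.2 h.root_subset]
  | @graft U₁ R U₂ R₂ n' m' h₁ h₂ hd' hadj' hW hD ih _ =>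
    have hR := h₁.root_subset
    rw [← Finset.union_assoc, ← add_assoc]
    refine (ih h (fun u hu => hd ?_)
      fun u hu v hv => hadj u hu v (Finset.mem_union_left _ hv)).graft h₂ ?_ ?_ hW hD
    · exact Finset.inter_subset_inter_left Finset.subset_union_left hu
    · rw [Finset.disjoint_union_left]
      refine ⟨Finset.disjoint_left.2 fun u hu hu' => ?_, hd'⟩
      exact Finset.disjoint_left.1 hd'
        (hR (hd (Finset.mem_inter.2 ⟨hu, Finset.mem_union_right _ hu'⟩))) hu'
    · intro u hu v hv huv
      by_cases hu₁ : u ∈ U₁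
      · exact hadj' u hu₁ v hv huv
      · have hu := (Finset.mem_union.1 hu).resolve_right hu₁
        rcases hadj u hu v (Finset.mem_union_right _ hv) huv with h' | h'
        · exact absurd (hR h') hu₁
        · exact absurd hv (Finset.disjoint_left.1 hd' (hR h'))

/-- Two rooted tree-partitions whose vertex sets overlap only in the root parts can be combined by
identifying the roots. -/
theorem merge {U U' R R' : Finset V} {n m : ℕ} (h : HasRootedTreePartition G W D U R n)
    (h' : HasRootedTreePartition G W D U' R' m) (hd : U ∩ U' ⊆ R ∩ R')
    (hadj : ∀ u ∈ U, ∀ v ∈ U', G.Adj u v → u ∈ U' ∨ v ∈ U) :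
    HasRootedTreePartition G W D (U ∪ U') (R ∪ R') (n + m) := by
  have hR := h.root_subset
  have hR' := h'.root_subset
  have hmem : ∀ u ∈ U, u ∈ U' → u ∈ R ∧ u ∈ R' := fun u hu hu' =>
    Finset.mem_inter.1 (hd (Finset.mem_inter.2 ⟨hu, hu'⟩))
  have e : HasRootedTreePartition G W D (U ∪ R' \ R) (R ∪ R' \ R) n :=
    h.union_root _ (Finset.disjoint_left.2 fun u hu hu' => by grind) fun u hu v hv huv => by grind
  have e' : HasRootedTreePartition G W D (U' ∪ R \ R') (R' ∪ R \ R') m :=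
    h'.union_root _ (Finset.disjoint_left.2 fun u hu hu' => by grind) fun u hu v hv huv => by
      have := hadj v (by grind) u hu huv.symm
      grind
  rw [Finset.union_sdiff_self_eq_union] at e e'
  rw [Finset.union_comm R' R] at e'
  have := e.merge_of_root_eq e' (fun u hu => by grind) (fun u hu v hv huv => by
    have := hadj u
    have := hadj v
    have := huv.symm
    grind)
  convert this using 1
  ext u
  grind

theorem exists_tree {U R : Finset V} {n : ℕ} (h : HasRootedTreePartition G W D U R n) :
    ∃ (ι : Type) (_ : Fintype ι) (T : SimpleGraph ι) (f : V → ι) (z : ι), T.IsTree ∧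
      (∀ x, ∃ u ∈ U, f u = x) ∧ (∀ u ∈ U, f u = z ↔ u ∈ R) ∧
      (∀ u ∈ U, ∀ v ∈ U, G.Adj u v → f u = f v ∨ T.Adj (f u) (f v)) ∧
      (∀ x, x ≠ z → ({u | u ∈ U ∧ f u = x}.ncard : ℝ) ≤ W) ∧
      (∀ x, x ≠ z → ((T.neighborSet x).ncard : ℝ) ≤ D) ∧ (T.neighborSet z).ncard ≤ n := by
  classical
  induction h with
  | single R hR =>
    obtain ⟨r, hr⟩ := hR
    exact ⟨Unit, inferInstance, ⊥, fun _ => (), (), .of_subsingleton, fun _ => ⟨r, hr, rfl⟩,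
      fun u hu => by simpa using hu, fun _ _ _ _ _ => .inl rfl, fun x hx => absurd rfl hx,
      fun x hx => absurd rfl hx, by simp [SimpleGraph.neighborSet]⟩
  | @graft U R U' R' n m h h' hd hadj hW hD ih ih' =>
    obtain ⟨ι, _, T, f, z, hT, hf, hz, he, hw, hdeg, hn⟩ := ih
    obtain ⟨ι', _, T', f', z', hT', hf', hz', he', hw', hdeg', hn'⟩ := ih'
    have hd' := Finset.disjoint_left.1 hd
    let g : V → ι ⊕ ι' := fun u => if u ∈ U then .inl (f u) else .inr (f' u)
    have hg : ∀ u ∈ U, g u = .inl (f u) := fun u hu => if_pos hu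
    have hg' : ∀ u ∈ U', g u = .inr (f' u) := fun u hu => if_neg fun h => hd' h hu
    let Q := T.sum T' ⊔ edge (.inl z) (.inr z')
    have hl : ∀ x y, Q.Adj (.inl x) (.inl y) ↔ T.Adj x y := fun x y => by simp [Q, edge_adj]
    have hr : ∀ x y, Q.Adj (.inr x) (.inr y) ↔ T'.Adj x y := fun x y => by simp [Q, edge_adj]
    have hlr : ∀ x y, Q.Adj (.inl x) (.inr y) ↔ x = z ∧ y = z' := fun x y => by
      simp [Q, edge_adj]
    have hrl : ∀ x y, Q.Adj (.inr x) (.inl y) ↔ y = z ∧ x = z' := fun x y => by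
      rw [adj_comm, hlr]
    have hcross : ∀ u ∈ U, ∀ v ∈ U', G.Adj u v → Q.Adj (g u) (g v) := fun u hu v hv huv => by
      rw [hg u hu, hg' v hv, hlr, hz u hu, hz' v hv]
      exact hadj u hu v hv huv
    have hdl : ∀ x, x ≠ z → Q.neighborSet (.inl x) = Sum.inl '' T.neighborSet x := fun x hx => by
      ext (y | y) <;> simp [mem_neighborSet, hl, hlr, hx]
    have hdr : ∀ x, x ≠ z' → Q.neighborSet (.inr x) = Sum.inr '' T'.neighborSet x :=
      fun x hx => by ext (y | y) <;> simp [mem_neighborSet, hr, hrl, hx]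
    have hdz : Q.neighborSet (.inl z) = insert (.inr z') (Sum.inl '' T.neighborSet z) := by
      ext (y | y) <;> simp [mem_neighborSet, hl, hlr]
    have hdz' : Q.neighborSet (.inr z') = insert (.inl z) (Sum.inr '' T'.neighborSet z') := by
      ext (y | y) <;> simp [mem_neighborSet, hr, hrl]
    have hpl : ∀ x, {u | u ∈ U ∪ U' ∧ g u = .inl x} = {u | u ∈ U ∧ f u = x} := fun x => by
      ext u
      by_cases hu : u ∈ U
      · simp [hu, hg u hu]
      · by_cases hu' : u ∈ U' <;> simp_all
    have hpr : ∀ x, {u | u ∈ U ∪ U' ∧ g u = .inr x} = {u | u ∈ U' ∧ f' u = x} := fun x => by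
      ext u
      by_cases hu : u ∈ U
      · simp [hu, hg u hu, hd' hu]
      · by_cases hu' : u ∈ U' <;> simp_all
    refine ⟨ι ⊕ ι', inferInstance, Q, g, .inl z, hT.sum_sup_edge hT' z z', ?_, ?_, ?_, ?_, ?_, ?_⟩
    · rintro (x | x)
      · obtain ⟨u, hu, rfl⟩ := hf x
        exact ⟨u, Finset.mem_union_left _ hu, hg u hu⟩
      · obtain ⟨u, hu, rfl⟩ := hf' x
        exact ⟨u, Finset.mem_union_right _ hu, hg' u hu⟩
    · intro u hu
      rcases Finset.mem_union.1 hu with hu | hu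
      · rw [hg u hu, Sum.inl.injEq, hz u hu]
      · simp only [hg' u hu, reduceCtorEq, false_iff]
        exact fun hR => hd' (h.root_subset hR) hu
    · intro u hu v hv huv
      rcases Finset.mem_union.1 hu with hu | hu <;> rcases Finset.mem_union.1 hv with hv | hv
      · rw [hg u hu, hg v hv, hl, Sum.inl.injEq]
        exact he u hu v hv huv
      · exact .inr (hcross u hu v hv huv)
      · exact .inr (hcross v hv u hu huv.symm).symm
      · rw [hg' u hu, hg' v hv, hr, Sum.inr.injEq]
        exact he' u hu v hv huv
    · rintro (x | x) hx
      · rw [hpl]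
        exact hw x (by simpa using hx)
      · rw [hpr]
        by_cases hxz : x = z'
        · have : {u | u ∈ U' ∧ f' u = x} = (R' : Set V) := by
            ext u
            rw [Set.mem_ofPred_eq, hxz]
            exact ⟨fun hu => (hz' u hu.1).1 hu.2,
              fun hu => ⟨h'.root_subset hu, (hz' u (h'.root_subset hu)).2 hu⟩⟩
          rwa [this, Set.ncard_coe_finset]
        · exact hw' x hxz
    · rintro (x | x) hx
      · have hx : x ≠ z := by simpa using hx
        rw [hdl x hx, Set.ncard_image_of_injective _ Sum.inl_injective]
        exact hdeg x hx
      · by_cases hxz : x = z'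
        · rw [hxz, hdz']
          refine le_trans ?_ hD
          exact_mod_cast (Set.ncard_insert_le _ _).trans (by
            rw [Set.ncard_image_of_injective _ Sum.inr_injective]
            exact Nat.add_le_add_right hn' 1)
        · rw [hdr x hxz, Set.ncard_image_of_injective _ Sum.inr_injective]
          exact hdeg' x hxz
    · rw [hdz]
      refine (Set.ncard_insert_le _ _).trans ?_
      rw [Set.ncard_image_of_injective _ Sum.inl_injective]
      exact Nat.add_le_add_right hn 1

end HasRootedTreePartition

end RootedTreePartition

theorem Finset.exists_superset_card_ge {V : Type*} {N M : Finset V} (hNM : N ⊆ M)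
    {a b : ℝ} (ha : 0 ≤ a) (hab : a + 1 ≤ b) (hN : (N.card : ℝ) ≤ b) (hM : a ≤ M.card) :
    ∃ S, N ⊆ S ∧ S ⊆ M ∧ a ≤ S.card ∧ (S.card : ℝ) ≤ b := by
  by_cases h : a ≤ N.card
  · exact ⟨N, subset_rfl, hNM, h, hN⟩
  · push Not at h
    obtain ⟨S, hNS, hSM, hS⟩ := Finset.exists_subsuperset_card_eq hNM
      (Nat.cast_le.1 (h.le.trans (Nat.le_ceil a))) (Nat.ceil_le.2 hM)
    refine ⟨S, hNS, hSM, hS ▸ Nat.le_ceil a, ?_⟩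
    rw [hS]
    exact (Nat.ceil_lt_add_one ha).le.trans hab

section Main

variable {V : Type} [Fintype V] [DecidableEq V] {G : SimpleGraph V} {k d : ℕ} {α W D : ℝ}

open Classical in
theorem card_boundary_le (hΔ : ∀ v, (G.neighborSet v).ncard ≤ d) (U S : Finset V) :
    {v ∈ U \ S | ∃ u ∈ S, G.Adj u v}.card ≤ S.card * d := by
  refine (Finset.card_le_card (t := S.biUnion fun u => {v | G.Adj u v}) fun v hv => ?_).trans
    (Finset.card_biUnion_le_card_mul _ _ _ fun u _ => ?_)
  · simpa using (Finset.mem_filter.1 hv).2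
  · refine le_trans (le_of_eq ?_) (hΔ u)
    rw [← Set.ncard_coe_finset]
    congr 1
    ext v
    simp

/-- If `3 * k < #S` and `S ⊆ U`, then `U` is covered by two smaller sets `U₁`, `U₂` that meet in at
most `k` vertices and have no other adjacency, such that adding `U₁ ∩ U₂` to the trace of `S` on
either of them gives sets `S₁`, `S₂` of size roughly between one and two thirds of that of `S`. -/
theorem IsTreeDecomp.exists_balanced_cover {ι : Type*} [Fintype ι] {T : SimpleGraph ι}
    {B : ι → Set V} (hB : IsTreeDecomp G T B) (hw : ∀ x, (B x).ncard ≤ k) {U S : Finset V}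
    (hSU : S ⊆ U) (hS : 3 * k < S.card) :
    ∃ U₁ U₂ S₁ S₂ : Finset V, U₁ ∪ U₂ = U ∧ U₁.card < U.card ∧ U₂.card < U.card ∧
      (∀ u ∈ U₁, ∀ v ∈ U₂, G.Adj u v → u ∈ U₂ ∨ v ∈ U₁) ∧ S₁ ⊆ U₁ ∧ S₂ ⊆ U₂ ∧ S ⊆ S₁ ∪ S₂ ∧
      U₁ ∩ U₂ ⊆ S₁ ∩ S₂ ∧ (U₁ ∩ U₂).card ≤ k ∧ S.card ≤ 3 * S₁.card ∧ S.card ≤ 3 * S₂.card ∧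
      3 * S₁.card ≤ 2 * S.card + 3 * k ∧ 3 * S₂.card ≤ 2 * S.card + 3 * k ∧
      S₁.card + S₂.card ≤ S.card + 2 * (U₁ ∩ U₂).card := by
  classical
  obtain ⟨x, P, hP, hP₁, hP₂⟩ := hB.exists_balanced_separation S
  obtain ⟨X, hX⟩ : ∃ X : Finset V, ∀ v, v ∈ X ↔ v ∈ U ∧ v ∈ B x :=
    ⟨{v ∈ U | v ∈ B x}, fun v => Finset.mem_filter⟩
  obtain ⟨A, hA⟩ : ∃ A : Finset V, ∀ v, v ∈ A ↔ v ∈ U ∧ v ∉ B x ∧ v ∈ P :=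
    ⟨{v ∈ U | v ∉ B x ∧ v ∈ P}, fun v => Finset.mem_filter⟩
  obtain ⟨C, hC⟩ : ∃ C : Finset V, ∀ v, v ∈ C ↔ v ∈ U ∧ v ∉ B x ∧ v ∉ P :=
    ⟨{v ∈ U | v ∉ B x ∧ v ∉ P}, fun v => Finset.mem_filter⟩
  have hXk : X.card ≤ k := by
    refine le_trans ?_ (hw x)
    rw [← Set.ncard_coe_finset]
    exact Set.ncard_le_ncard fun v hv => ((hX v).1 hv).2
  have hSA := hP₁ (S ∩ A) Finset.inter_subset_left fun v hv =>
    ((hA v).1 (Finset.mem_inter.1 hv).2).2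
  have hSC := hP₂ (S ∩ C) Finset.inter_subset_left fun v hv =>
    ((hC v).1 (Finset.mem_inter.1 hv).2).2
  clear hP₁ hP₂
  have hcA := Finset.card_union_of_disjoint (s := S ∩ A) (t := X)
    (Finset.disjoint_left.2 fun v => by grind)
  have hcC := Finset.card_union_of_disjoint (s := S ∩ C) (t := X)
    (Finset.disjoint_left.2 fun v => by grind)
  have hcAC := Finset.card_union_of_disjoint (s := S ∩ A) (t := S ∩ C)
    (Finset.disjoint_left.2 fun v => by grind)
  have hsum := Finset.card_le_card (Finset.union_subset (Finset.inter_subset_left (s₁ := S)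
    (s₂ := A)) (Finset.inter_subset_left (s₁ := S) (s₂ := C)))
  have hcov := (Finset.card_le_card (show S ⊆ S ∩ A ∪ S ∩ C ∪ X from fun v hv => by
    have := hSU hv
    grind)).trans (Finset.card_union_le _ _)
  have hinter : (A ∪ X) ∩ (C ∪ X) = X := by
    ext v
    simp only [Finset.mem_union, Finset.mem_inter, hX, hA, hC]
    tauto
  refine ⟨A ∪ X, C ∪ X, S ∩ A ∪ X, S ∩ C ∪ X, ?_, ?_, ?_, ?_,
    Finset.union_subset_union_left Finset.inter_subset_right,
    Finset.union_subset_union_left Finset.inter_subset_right, ?_, ?_,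
    by rwa [hinter], by omega, by omega, by omega, by omega, by rw [hinter]; omega⟩
  · ext v
    simp only [Finset.mem_union, hX, hA, hC]
    tauto
  · obtain ⟨v, hv⟩ : (S ∩ C).Nonempty := by
      rw [← Finset.card_pos]
      omega
    rw [Finset.mem_inter, hC] at hv
    refine Finset.card_lt_card (Finset.ssubset_iff_of_subset (fun u hu => ?_) |>.2
      ⟨v, hv.2.1, ?_⟩)
    · simp only [Finset.mem_union, hX, hA] at hu
      tauto
    · simp only [Finset.mem_union, hX, hA]
      tauto
  · obtain ⟨v, hv⟩ : (S ∩ A).Nonempty := by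
      rw [← Finset.card_pos]
      omega
    rw [Finset.mem_inter, hA] at hv
    refine Finset.card_lt_card (Finset.ssubset_iff_of_subset (fun u hu => ?_) |>.2
      ⟨v, hv.2.1, ?_⟩)
    · simp only [Finset.mem_union, hX, hC] at hu
      tauto
    · simp only [Finset.mem_union, hX, hC]
      tauto
  · intro u hu v hv huv
    have := hP huv
    simp only [Finset.mem_union, hX, hA, hC] at hu hv ⊢
    tauto
  · intro v hv
    have := hSU hv
    simp only [Finset.mem_union, Finset.mem_inter, hX, hA, hC]
    tauto
  · rw [hinter]
    exact Finset.subset_inter Finset.subset_union_right Finset.subset_union_right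

theorem IsTreeDecomp.exists_hasRootedTreePartition {ι : Type*} [Fintype ι] {T : SimpleGraph ι}
    {B : ι → Set V} (hB : IsTreeDecomp G T B) (hw : ∀ x, (B x).ncard ≤ k)
    (hΔ : ∀ v, (G.neighborSet v).ncard ≤ d) (hk : 1 ≤ k) (hd : 1 ≤ d) (hα : 2 < α)
    (hW : (α - 2) * W = 3 * α * (α - 1) * (k * d) - α * k)
    (hD : (α - 2) * D = 3 * α * d + (α - 4)) (U S : Finset V) (hSU : S ⊆ U)
    (hS : α * k ≤ S.card) (hS' : (S.card : ℝ) ≤ 3 * α * (k * d)) :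
    ∃ R n, HasRootedTreePartition G W D U R n ∧ S ⊆ R ∧
      (α - 2) * R.card ≤ (α - 1) * S.card - α * k ∧ (α - 2) * k * n ≤ S.card - 2 * k := by
  classical
  have hα' : 0 < α - 2 := by linarith
  have hk' : (1 : ℝ) ≤ k := by exact_mod_cast hk
  have hd' : (1 : ℝ) ≤ d := by exact_mod_cast hd
  have hkd : (k : ℝ) ≤ k * d := by nlinarith
  have hαk : 2 * (k : ℝ) < α * k := by nlinarith
  have hαkd : α * (k : ℝ) ≤ α * (k * d) := by nlinarith
  have hW' : α * k ≤ W := by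
    refine le_of_mul_le_mul_left ?_ hα'
    rw [hW]
    nlinarith [mul_le_mul_of_nonneg_left hαkd (by linarith : 0 ≤ 3 * (α - 1))]
  have hD' : 1 ≤ D := by
    refine le_of_mul_le_mul_left ?_ hα'
    rw [hD]
    nlinarith
  induction hU : U.card using Nat.strong_induction_on generalizing U S with
  | _ N ih =>
  have hSne : S.Nonempty := by
    rw [← Finset.card_pos, ← Nat.cast_pos (α := ℝ)]
    linarith
  have hSr : (α - 2) * S.card ≤ (α - 1) * S.card - α * k := by linarith
  have hU' : S ∪ U \ S = U := Finset.union_sdiff_of_subset hSU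
  by_cases h0 : (U \ S).card < α * k
  · rcases (U \ S).eq_empty_or_nonempty with he | hne
    · rw [he, Finset.union_empty] at hU'
      subst hU'
      exact ⟨S, 0, .single S hSne, subset_rfl, hSr, by push_cast; linarith⟩
    · refine ⟨S, 0 + 1, hU' ▸ (HasRootedTreePartition.single S hSne).graft (.single (U \ S) hne)
        Finset.disjoint_sdiff (fun u hu v hv _ => ⟨hu, hv⟩) (h0.le.trans hW') (by simpa using hD'),
        subset_rfl, hSr, ?_⟩
      push_cast
      linarith
  push Not at h0
  by_cases h1 : (S.card : ℝ) < 3 * α * k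
  · obtain ⟨S₁, hN, hS₁, h2, h3⟩ := Finset.exists_superset_card_ge
      (Finset.filter_subset (fun v => ∃ u ∈ S, G.Adj u v) (U \ S)) (a := α * k)
      (b := 3 * α * (k * d)) (by linarith) (by linarith) (by
        have : (({v ∈ U \ S | ∃ u ∈ S, G.Adj u v}.card : ℕ) : ℝ) ≤ S.card * d := by
          exact_mod_cast card_boundary_le hΔ U S
        nlinarith) h0
    obtain ⟨R, n, hR, hSR, hRc, hn⟩ := ih _ (by
      rw [← hU]
      exact Finset.card_lt_card (Finset.sdiff_ssubset hSU hSne)) (U \ S) S₁ hS₁ h2 h3 rfl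
    refine ⟨S, 0 + 1, hU' ▸ (HasRootedTreePartition.single S hSne).graft hR Finset.disjoint_sdiff
      (fun u hu v hv huv => ⟨hu, hSR (hN (Finset.mem_filter.2 ⟨hv, u, hu, huv⟩))⟩) ?_ ?_,
      subset_rfl, hSr, by push_cast; linarith⟩
    · refine le_of_mul_le_mul_left ?_ hα'
      rw [hW]
      nlinarith [mul_le_mul_of_nonneg_left h3 (by linarith : 0 ≤ α - 1)]
    · refine le_of_mul_le_mul_left (a := (α - 2) * k) ?_ (by positivity)
      have : (α - 2) * k * D = k * (3 * α * d + (α - 4)) := by rw [← hD]; ring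
      rw [this]
      linarith
  push Not at h1
  obtain ⟨U₁, U₂, S₁, S₂, hUU, hU₁, hU₂, hadj, hS₁, hS₂, hSS, hX, hXk, h2, h3, h4, h5, h6⟩ :=
    hB.exists_balanced_cover hw hSU (by rify; linarith)
  rify at hXk h2 h3 h4 h5 h6
  obtain ⟨R₁, n₁, hR₁, hSR₁, hRc₁, hn₁⟩ :=
    ih _ (hU ▸ hU₁) U₁ S₁ hS₁ (by linarith) (by linarith) rfl
  obtain ⟨R₂, n₂, hR₂, hSR₂, hRc₂, hn₂⟩ :=
    ih _ (hU ▸ hU₂) U₂ S₂ hS₂ (by linarith) (by linarith) rfl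
  have hXR := hX.trans (Finset.inter_subset_inter hSR₁ hSR₂)
  refine ⟨R₁ ∪ R₂, n₁ + n₂, hUU ▸ hR₁.merge hR₂ hXR hadj,
    hSS.trans (Finset.union_subset_union hSR₁ hSR₂), ?_, ?_⟩
  · have h7 : ((R₁ ∪ R₂).card : ℝ) + (R₁ ∩ R₂).card = R₁.card + R₂.card := by
      exact_mod_cast Finset.card_union_add_card_inter R₁ R₂
    have h8 : ((U₁ ∩ U₂).card : ℝ) ≤ (R₁ ∩ R₂).card := Nat.cast_le.2 (Finset.card_le_card hXR)
    linarith [congrArg ((α - 2) * ·) h7, mul_le_mul_of_nonneg_left h8 hα'.le,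
      mul_le_mul_of_nonneg_left h6 (by linarith : 0 ≤ α - 1),
      mul_le_mul_of_nonneg_left hXk (by linarith : 0 ≤ α)]
  · push_cast
    linarith

end Main

/-- Fix positive integers `k`, `d` and a real `α > 2`. Every graph `G`
with `tw(G) ≤ k − 1` and `Δ(G) ≤ d` has a tree-partition of width at most
`(3α(α−1)/(α−2))·kd − (α/(α−2))·k` over a tree `T` with
`Δ(T) ≤ (3α/(α−2))·d + (α−4)/(α−2)`. -/
theorem exists_treePartition_alpha (k d : ℕ) (hk : 1 ≤ k) (hd : 1 ≤ d)
    (α : ℝ) (hα : 2 < α)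
    {V : Type} [Fintype V] [Nonempty V] (G : SimpleGraph V)
    (htw : treewidth G ≤ k - 1) (hΔ : maxDeg G ≤ d) :
    ∃ (ι : Type) (_ : Fintype ι) (T : SimpleGraph ι) (B : ι → Set V),
      IsTreePartition G T B ∧
      (∀ x, ((B x).ncard : ℝ) ≤ 3 * α * (α - 1) / (α - 2) * (k * d) - α / (α - 2) * k) ∧
      (∀ x, ((T.neighborSet x).ncard : ℝ) ≤ 3 * α / (α - 2) * d + (α - 4) / (α - 2)) := by
  classical
  obtain ⟨κ, _, S, C, hC, hw⟩ := exists_isTreeDecomp_ncard_le G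
  have hα' : 0 < α - 2 := by linarith
  have hk' : (1 : ℝ) ≤ k := by exact_mod_cast hk
  have hd' : (1 : ℝ) ≤ d := by exact_mod_cast hd
  have hαk : 2 * (k : ℝ) < α * k := by nlinarith
  have hαkd : α * (k : ℝ) ≤ α * (k * d) := by
    have : (k : ℝ) ≤ k * d := by nlinarith
    nlinarith
  set W := 3 * α * (α - 1) / (α - 2) * (k * d) - α / (α - 2) * k with hW
  set D := 3 * α / (α - 2) * d + (α - 4) / (α - 2) with hD
  replace hW : (α - 2) * W = 3 * α * (α - 1) * (k * d) - α * k := by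
    rw [hW]; field_simp
  replace hD : (α - 2) * D = 3 * α * d + (α - 4) := by
    rw [hD]; field_simp
  obtain ⟨R, n, hR, hRW, hn⟩ : ∃ R n, HasRootedTreePartition G W D Finset.univ R n ∧
      (R.card : ℝ) ≤ W ∧ (n : ℝ) ≤ D := by
    by_cases hV : (Finset.univ : Finset V).card < α * k
    · refine ⟨Finset.univ, 0, .single _ Finset.univ_nonempty, ?_, ?_⟩
      · refine le_of_mul_le_mul_left ?_ hα'
        rw [hW]
        nlinarith [mul_le_mul_of_nonneg_left hαkd (by linarith : 0 ≤ 3 * (α - 1)),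
          mul_le_mul_of_nonneg_left hV.le hα'.le]
      · refine le_of_mul_le_mul_left ?_ hα'
        rw [hD]
        push_cast
        nlinarith
    push Not at hV
    obtain ⟨S₀, -, -, h1, h2⟩ := Finset.exists_superset_card_ge
      (Finset.empty_subset (Finset.univ : Finset V)) (a := α * k) (b := 3 * α * (k * d))
      (by linarith) (by linarith) (by rw [Finset.card_empty]; push_cast; linarith) hV
    obtain ⟨R, n, hR, -, hRc, hn⟩ := hC.exists_hasRootedTreePartition
      (fun x => (hw x).trans (by omega)) (fun v => (ncard_neighborSet_le_maxDeg G v).trans hΔ)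
      hk hd hα hW hD Finset.univ S₀ (Finset.subset_univ _) h1 h2
    refine ⟨R, n, hR, ?_, ?_⟩
    · refine le_of_mul_le_mul_left ?_ hα'
      rw [hW]
      nlinarith [mul_le_mul_of_nonneg_left h2 (by linarith : 0 ≤ α - 1)]
    · refine le_of_mul_le_mul_left (a := (α - 2) * k) ?_ (by positivity)
      have : (α - 2) * k * D = k * (3 * α * d + (α - 4)) := by rw [← hD]; ring
      rw [this]
      nlinarith
  obtain ⟨ι, hι, T, f, z, hT, hf, hz, he, hw', hdeg, hn'⟩ := hR.exists_tree
  refine ⟨ι, hι, T, fun x => {v | f v = x},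
    ⟨hT, fun x => ?_, fun v => ⟨f v, rfl, fun y hy => hy.symm⟩, ?_⟩, fun x => ?_, fun x => ?_⟩
  · obtain ⟨u, -, hu⟩ := hf x
    exact ⟨u, hu⟩
  · rintro v w x y hvw rfl rfl
    exact he v (Finset.mem_univ _) w (Finset.mem_univ _) hvw
  · change ({v | f v = x}.ncard : ℝ) ≤ W
    by_cases hx : x = z
    · have : {v | f v = x} = (R : Set V) := by
        ext v
        rw [hx]
        exact hz v (Finset.mem_univ _)
      rwa [this, Set.ncard_coe_finset]
    · simpa using hw' x hx
  · by_cases hx : x = z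
    · rw [hx]
      exact (Nat.cast_le.2 hn').trans hn
    · exact hdeg x hx
end
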